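/- arXiv:2303.05335 — 3 statements merged into one kernel-verified Lean document; each statement's English description precedes it below -/
import Mathlib

section
/- Let H be a right quaternionic Hilbert space and T ∈ B(H). The continuous spectrum σ_c(T) is a circular subset of ℍ: if λ ∈ σ_c(T) and q ∈ ℍ with |q| = 1, then qλq* ∈ σ_c(T). -/
open MulOpposite Filter Topology Quaternion

noncomputable section

/- We model a right quaternionic Hilbert space as a real Banach space `H` equipped with a
right `ℍ`-module structure (encoded as a `ℍ[ℝ]ᵐᵒᵖ`-module, so that `x·q` is `op q • x`),
compatible with the real structure (`hreal`) and with the norm (`hnorm`). -/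

variable {H : Type*} [NormedAddCommGroup H] [NormedSpace ℝ H] [Module ℍ[ℝ]ᵐᵒᵖ H]

/-- The operator `T_λ : x ↦ x·λ - T x`. -/
def opTlam (T : H →L[ℝ] H) (l : ℍ[ℝ]) : H → H := fun x => op l • x - T x

/-- The operator `Δ_λ(T) = T² - 2 Re(λ) T + |λ|² I`. -/
def opDelta (T : H →L[ℝ] H) (l : ℍ[ℝ]) : H → H :=
  fun x => T (T x) - (2 * l.re) • T x + (‖l‖ ^ 2) • x

/-- A map is right `ℍ`-linear when it commutes with the right quaternionic scalar action
(together with additivity, which is automatic for the bundled maps we use). -/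
def IsRightQLinear (S : H → H) : Prop := ∀ (q : ℍ[ℝ]) (x : H), S (op q • x) = op q • S x

/-- Invertibility in `B_ℝ(H)`: existence of a two-sided inverse which is a bounded
`ℝ`-linear operator. -/
def InvertibleInBR (f : H → H) : Prop :=
  ∃ S : H →L[ℝ] H, (∀ x, S (f x) = x) ∧ (∀ x, f (S x) = x)

/-- Invertibility in `B(H)`: existence of a two-sided inverse which is a bounded
right `ℍ`-linear operator. -/
def InvertibleInBH (f : H → H) : Prop :=
  ∃ S : H →L[ℝ] H, IsRightQLinear (S : H → H) ∧ (∀ x, S (f x) = x) ∧ (∀ x, f (S x) = x)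

/-- An operator is bounded below if `‖f x‖ ≥ k ‖x‖` for some `k > 0`. -/
def BoundedBelowOp (f : H → H) : Prop := ∃ k > 0, ∀ x : H, k * ‖x‖ ≤ ‖f x‖

/-- The right spectrum `σ(T)`. -/
def rightSpectrum (T : H →L[ℝ] H) : Set ℍ[ℝ] := {l | ¬ InvertibleInBR (opTlam T l)}

/-- The S-spectrum `σ_S(T)`. -/
def sSpectrum (T : H →L[ℝ] H) : Set ℍ[ℝ] := {l | ¬ InvertibleInBH (opDelta T l)}

/-- The point spectrum `σ_p(T)`. -/
def pointSpectrum (T : H →L[ℝ] H) : Set ℍ[ℝ] := {l | ∃ x : H, x ≠ 0 ∧ opTlam T l x = 0}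

/-- The point S-spectrum `σ_{S,p}(T)`. -/
def sPointSpectrum (T : H →L[ℝ] H) : Set ℍ[ℝ] := {l | ∃ x : H, x ≠ 0 ∧ opDelta T l x = 0}

/-- The residual spectrum `σ_r(T)`. -/
def residualSpectrum (T : H →L[ℝ] H) : Set ℍ[ℝ] :=
  {l | l ∉ pointSpectrum T ∧ ¬ Dense (Set.range (opTlam T l))}

/-- The residual S-spectrum `σ_{S,r}(T)`. -/
def sResidualSpectrum (T : H →L[ℝ] H) : Set ℍ[ℝ] :=
  {l | l ∉ sPointSpectrum T ∧ ¬ Dense (Set.range (opDelta T l))}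

/-- The continuous spectrum `σ_c(T)`. -/
def continuousSpectrum (T : H →L[ℝ] H) : Set ℍ[ℝ] :=
  {l | l ∉ pointSpectrum T ∧ l ∉ residualSpectrum T ∧ ¬ BoundedBelowOp (opTlam T l)}

/-- The continuous S-spectrum `σ_{S,c}(T)`. -/
def sContinuousSpectrum (T : H →L[ℝ] H) : Set ℍ[ℝ] :=
  {l | l ∉ sPointSpectrum T ∧ l ∉ sResidualSpectrum T ∧ ¬ BoundedBelowOp (opDelta T l)}

/-- Conjugating the parameter by `q` conjugates `T_λ` by right multiplication by `q`. -/
theorem opTlam_conj (T : H →L[ℝ] H) (hT : IsRightQLinear (T : H → H)) {q : ℍ[ℝ]}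
    (hq : q * star q = 1) (l : ℍ[ℝ]) (x : H) :
    opTlam T (q * l * star q) x = op (star q) • opTlam T l (op q • x) := by
  simp only [opTlam, smul_sub, hT q x, smul_smul, ← op_mul, hq, op_one, one_smul, mul_assoc]

/-- Right multiplication by a quaternion is continuous. -/
theorem continuous_op_smul (hnorm : ∀ (x : H) (q : ℍ[ℝ]), ‖op q • x‖ = ‖x‖ * ‖q‖)
    (q : ℍ[ℝ]) : Continuous fun x : H => op q • x :=
  (LipschitzWith.of_dist_le_mul (K := ‖q‖₊) fun x y => by
    rw [dist_eq_norm, dist_eq_norm, ← smul_sub, hnorm, mul_comm, coe_nnnorm]).continuous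

/-- The continuous spectrum is circular: if `λ ∈ σ_c(T)` and `|q| = 1` then `qλq* ∈ σ_c(T)`. -/
theorem continuousSpectrum_circular [CompleteSpace H] (T : H →L[ℝ] H)
    (hT : IsRightQLinear (T : H → H))
    (hreal : ∀ (r : ℝ) (x : H), op ((r : ℍ[ℝ])) • x = r • x)
    (hnorm : ∀ (x : H) (q : ℍ[ℝ]), ‖op q • x‖ = ‖x‖ * ‖q‖)
    (l q : ℍ[ℝ]) (hq : ‖q‖ = 1) (hl : l ∈ continuousSpectrum T) :
    q * l * star q ∈ continuousSpectrum T := by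
  have hq₁ : q * star q = 1 := by
    rw [Quaternion.self_mul_star, Quaternion.normSq_eq_norm_mul_self, hq]; simp
  have hq₂ : star q * q = 1 := by
    rw [Quaternion.star_mul_self, Quaternion.normSq_eq_norm_mul_self, hq]; simp
  have hiso (x : H) : ‖op q • x‖ = ‖x‖ := by rw [hnorm, hq, mul_one]
  have hiso_star (x : H) : ‖op (star q) • x‖ = ‖x‖ := by rw [hnorm, norm_star, hq, mul_one]
  have hinv (x : H) : op q • op (star q) • x = x := by
    rw [smul_smul, ← op_mul, hq₂, op_one, one_smul]
  have hinv_star (x : H) : op (star q) • op q • x = x := by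
    rw [smul_smul, ← op_mul, hq₁, op_one, one_smul]
  have hconj := opTlam_conj T hT hq₁ l
  obtain ⟨hp, hr, hb⟩ := hl
  have hdense : Dense (Set.range (opTlam T l)) := by
    by_contra h
    exact hr ⟨hp, h⟩
  refine ⟨?_, ?_, ?_⟩
  · rintro ⟨x, hx, h⟩
    refine hp ⟨op q • x, ?_, ?_⟩
    · rwa [← norm_ne_zero_iff, hiso, norm_ne_zero_iff]
    · rw [← norm_eq_zero, ← hiso_star, ← hconj, h, norm_zero]
  · rintro ⟨-, h⟩
    have hsurj : Function.Surjective fun x : H => op (star q) • x := fun x =>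
      ⟨op q • x, hinv_star x⟩
    refine h ((hsurj.denseRange.dense_image (continuous_op_smul hnorm _) hdense).mono ?_)
    rintro _ ⟨_, ⟨x, rfl⟩, rfl⟩
    exact ⟨op (star q) • x, by rw [hconj, hinv]⟩
  · rintro ⟨k, hk, h⟩
    refine hb ⟨k, hk, fun x => ?_⟩
    simpa only [hconj, hinv, hiso_star] using h (op (star q) • x)
end
end

section
/- Let H be a right quaternionic Hilbert space, T ∈ B(H), and λ ∈ ℍ. If the ranges of T_λ and of T_{λ*} are both dense in H, then the range of Δ_λ(T) = T_{λ*} ∘ T_λ is dense in H. Consequently, if Ran(T_λ) is dense in H then Ran(Δ_λ(T)) is dense in H. -/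
open MulOpposite Filter Topology Quaternion

noncomputable section

/- We model a right quaternionic Hilbert space as a real Banach space `H` equipped with a
right `ℍ`-module structure (encoded as a `ℍ[ℝ]ᵐᵒᵖ`-module, so that `x·q` is `op q • x`),
compatible with the real structure (`hreal`) and with the norm (`hnorm`). -/

variable {H : Type*} [NormedAddCommGroup H] [NormedSpace ℝ H] [Module ℍ[ℝ]ᵐᵒᵖ H]

theorem Quaternion.mul_eq_star_mul_of_re_eq_zero {q l : ℍ[ℝ]} (hq : q.re = 0)
    (h : q.imI * l.imI + q.imJ * l.imJ + q.imK * l.imK = 0) : q * l = star l * q := by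
  apply Quaternion.ext <;>
    simp only [Quaternion.re_mul, Quaternion.imI_mul, Quaternion.imJ_mul, Quaternion.imK_mul,
      Quaternion.re_star, Quaternion.imI_star, Quaternion.imJ_star, Quaternion.imK_star, hq]
  · linear_combination -2 * h
  all_goals ring

theorem Quaternion.exists_ne_zero_mul_eq_star_mul (l : ℍ[ℝ]) :
    ∃ q : ℍ[ℝ], q ≠ 0 ∧ q * l = star l * q := by
  by_cases h : l.imI = 0 ∧ l.imJ = 0
  · refine ⟨⟨0, 1, 0, 0⟩, fun h0 => one_ne_zero (congrArg QuaternionAlgebra.imI h0),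
      Quaternion.mul_eq_star_mul_of_re_eq_zero rfl ?_⟩
    simp [h.1]
  · refine ⟨⟨0, l.imJ, -l.imI, 0⟩, fun h0 => h ⟨?_, ?_⟩,
      Quaternion.mul_eq_star_mul_of_re_eq_zero rfl ?_⟩
    · exact neg_eq_zero.1 (congrArg QuaternionAlgebra.imJ h0)
    · exact congrArg QuaternionAlgebra.imI h0
    · ring

theorem continuous_op_smul_of_norm_eq {E : Type*} [NormedAddCommGroup E] [Module ℍ[ℝ]ᵐᵒᵖ E]
    (hnorm : ∀ (x : E) (q : ℍ[ℝ]), ‖op q • x‖ = ‖x‖ * ‖q‖) (q : ℍ[ℝ]) :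
    Continuous fun x : E => op q • x :=
  (LipschitzWith.of_dist_le_mul (K := ‖q‖₊) fun x y => by
    rw [dist_eq_norm, dist_eq_norm, ← smul_sub, hnorm, mul_comm, coe_nnnorm]).continuous

theorem continuous_opTlam (T : H →L[ℝ] H)
    (hnorm : ∀ (x : H) (q : ℍ[ℝ]), ‖op q • x‖ = ‖x‖ * ‖q‖) (l : ℍ[ℝ]) :
    Continuous (opTlam T l) :=
  (continuous_op_smul_of_norm_eq hnorm l).sub T.continuous

theorem opTlam_op_smul (T : H →L[ℝ] H) (hT : IsRightQLinear (T : H → H)) {q l m : ℍ[ℝ]}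
    (h : q * l = m * q) (x : H) : opTlam T l (op q • x) = op q • opTlam T m x := by
  simp only [opTlam, hT q x, smul_sub, smul_smul, ← op_mul, h]

theorem denseRange_opTlam_star (T : H →L[ℝ] H) (hT : IsRightQLinear (T : H → H))
    (hnorm : ∀ (x : H) (q : ℍ[ℝ]), ‖op q • x‖ = ‖x‖ * ‖q‖) {l : ℍ[ℝ]}
    (h : DenseRange (opTlam T l)) : DenseRange (opTlam T (star l)) := by
  obtain ⟨q, hq, hql⟩ := Quaternion.exists_ne_zero_mul_eq_star_mul l
  have hq' : op q ≠ 0 := (op_ne_zero_iff q).2 hq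
  have hconj : opTlam T (star l) ∘ (fun x => op q⁻¹ • x) =
      (fun x => op q⁻¹ • x) ∘ opTlam T l := by
    funext x
    apply MulAction.injective₀ hq'
    simp only [Function.comp_apply, ← opTlam_op_smul T hT hql, op_inv, smul_inv_smul₀ hq']
  have hsurj : Function.Surjective fun x : H => op q⁻¹ • x := fun x =>
    ⟨op q • x, by simp only [op_inv, inv_smul_smul₀ hq']⟩
  have hd : DenseRange (opTlam T (star l) ∘ fun x => op q⁻¹ • x) :=
    hconj ▸ hsurj.denseRange.comp h (continuous_op_smul_of_norm_eq hnorm _)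
  exact hd.mono (Set.range_comp_subset_range _ _)

theorem opDelta_eq_comp (T : H →L[ℝ] H) (hT : IsRightQLinear (T : H → H))
    (hreal : ∀ (r : ℝ) (x : H), op ((r : ℍ[ℝ])) • x = r • x) (l : ℍ[ℝ]) :
    opDelta T l = opTlam T (star l) ∘ opTlam T l := by
  funext x
  have hmul : op (star l) • op l • x = (‖l‖ ^ 2) • x := by
    rw [smul_smul, ← op_mul, Quaternion.self_mul_star, Quaternion.normSq_eq_norm_mul_self,
      ← sq, hreal]
  have hadd : op l • T x + op (star l) • T x = (2 * l.re) • T x := by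
    rw [← add_smul, ← op_add, Quaternion.self_add_star', hreal]
  simp only [opDelta, opTlam, Function.comp_apply, smul_sub, map_sub, hmul, hT l x, ← hadd]
  abel

/-- If `Ran(T_λ)` and `Ran(T_{λ*})` are dense then `Ran(Δ_λ(T))` is dense;
consequently `Ran(T_λ)` dense implies `Ran(Δ_λ(T))` dense. -/
theorem denseRange_delta [CompleteSpace H] (T : H →L[ℝ] H)
    (hT : IsRightQLinear (T : H → H))
    (hreal : ∀ (r : ℝ) (x : H), op ((r : ℍ[ℝ])) • x = r • x)
    (hnorm : ∀ (x : H) (q : ℍ[ℝ]), ‖op q • x‖ = ‖x‖ * ‖q‖)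
    (l : ℍ[ℝ]) :
    (Dense (Set.range (opTlam T l)) ∧ Dense (Set.range (opTlam T (star l))) →
      Dense (Set.range (opDelta T l))) ∧
    (Dense (Set.range (opTlam T l)) → Dense (Set.range (opDelta T l))) := by
  have key (h : DenseRange (opTlam T l)) : DenseRange (opDelta T l) := by
    rw [opDelta_eq_comp T hT hreal]
    exact (denseRange_opTlam_star T hT hnorm h).comp h (continuous_opTlam T hnorm _)
  exact ⟨fun h => key h.1, key⟩
end
end

section
/- Let H be a right quaternionic Hilbert space, T ∈ B(H), and λ ∈ ℍ. If T_λ is not bounded below, then Δ_λ(T) is not bounded below. Conversely, if Δ_λ(T) is not bounded below, then at least one of T_λ and T_{λ*} is not bounded below. -/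
open MulOpposite Filter Topology Quaternion

noncomputable section

/- We model a right quaternionic Hilbert space as a real Banach space `H` equipped with a
right `ℍ`-module structure (encoded as a `ℍ[ℝ]ᵐᵒᵖ`-module, so that `x·q` is `op q • x`),
compatible with the real structure (`hreal`) and with the norm (`hnorm`). -/

variable {H : Type*} [NormedAddCommGroup H] [NormedSpace ℝ H] [Module ℍ[ℝ]ᵐᵒᵖ H]

theorem norm_opTlam_le (T : H →L[ℝ] H)
    (hnorm : ∀ (x : H) (q : ℍ[ℝ]), ‖op q • x‖ = ‖x‖ * ‖q‖) (l : ℍ[ℝ]) (x : H) :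
    ‖opTlam T l x‖ ≤ (‖l‖ + ‖T‖) * ‖x‖ :=
  calc ‖opTlam T l x‖ ≤ ‖op l • x‖ + ‖T x‖ := norm_sub_le _ _
    _ ≤ ‖x‖ * ‖l‖ + ‖T‖ * ‖x‖ := by
        rw [hnorm]
        gcongr
        exact T.le_opNorm x
    _ = (‖l‖ + ‖T‖) * ‖x‖ := by ring

theorem opTlam_star_opTlam (T : H →L[ℝ] H)
    (hT : IsRightQLinear (T : H → H))
    (hreal : ∀ (r : ℝ) (x : H), op ((r : ℍ[ℝ])) • x = r • x)
    (l : ℍ[ℝ]) (x : H) :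
    opTlam T (star l) (opTlam T l x) = opDelta T l x := by
  have h₁ : op (star l) • op l • x = (‖l‖ ^ 2) • x := by
    rw [smul_smul, ← op_mul, Quaternion.self_mul_star, hreal, Quaternion.normSq_eq_norm_mul_self,
      sq]
  have h₂ : op l • T x + op (star l) • T x = (2 * l.re) • T x := by
    rw [← add_smul, ← op_add, Quaternion.self_add_star', hreal]
  simp only [opTlam, opDelta, smul_sub, map_sub, hT l x, h₁, ← h₂]
  abel

/-- A left factor that is bounded above transfers lower bounds to the right factor. -/
theorem BoundedBelowOp.of_comp {E : Type*} [NormedAddCommGroup E] {f g h : E → E} {C : ℝ}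
    (hg : ∀ x, ‖g x‖ ≤ C * ‖x‖) (hgf : ∀ x, g (f x) = h x) (hh : BoundedBelowOp h) :
    BoundedBelowOp f := by
  obtain ⟨k, hk, hb⟩ := hh
  have hC : 0 < |C| + 1 := by positivity
  refine ⟨k / (|C| + 1), div_pos hk hC, fun x => ?_⟩
  rw [div_mul_eq_mul_div, div_le_iff₀ hC, mul_comm ‖f x‖]
  calc k * ‖x‖ ≤ ‖g (f x)‖ := (hb x).trans_eq (by rw [hgf])
    _ ≤ C * ‖f x‖ := hg _
    _ ≤ (|C| + 1) * ‖f x‖ := by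
        gcongr
        linarith [le_abs_self C]

theorem BoundedBelowOp.comp {E : Type*} [NormedAddCommGroup E] {f g h : E → E}
    (hgf : ∀ x, g (f x) = h x)
    (hg : BoundedBelowOp g) (hf : BoundedBelowOp f) : BoundedBelowOp h := by
  obtain ⟨k, hk, hkg⟩ := hg
  obtain ⟨m, hm, hmf⟩ := hf
  refine ⟨k * m, mul_pos hk hm, fun x => ?_⟩
  calc k * m * ‖x‖ = k * (m * ‖x‖) := mul_assoc _ _ _
    _ ≤ k * ‖f x‖ := by gcongr; exact hmf x
    _ ≤ ‖h x‖ := (hkg _).trans_eq (by rw [hgf])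

/-- If `T_λ` is not bounded below then `Δ_λ(T)` is not bounded below; conversely, if
`Δ_λ(T)` is not bounded below then `T_λ` or `T_{λ*}` is not bounded below. -/
theorem boundedBelow_delta [CompleteSpace H] (T : H →L[ℝ] H)
    (hT : IsRightQLinear (T : H → H))
    (hreal : ∀ (r : ℝ) (x : H), op ((r : ℍ[ℝ])) • x = r • x)
    (hnorm : ∀ (x : H) (q : ℍ[ℝ]), ‖op q • x‖ = ‖x‖ * ‖q‖)
    (l : ℍ[ℝ]) :
    (¬ BoundedBelowOp (opTlam T l) → ¬ BoundedBelowOp (opDelta T l)) ∧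
    (¬ BoundedBelowOp (opDelta T l) →
      ¬ BoundedBelowOp (opTlam T l) ∨ ¬ BoundedBelowOp (opTlam T (star l))) := by
  have hcomp := opTlam_star_opTlam T hT hreal l
  refine ⟨mt (BoundedBelowOp.of_comp (norm_opTlam_le T hnorm (star l)) hcomp), fun h => ?_⟩
  contrapose! h
  exact BoundedBelowOp.comp hcomp h.2 h.1
end
end
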